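/- For all natural numbers n and k with k ≥ 5, the online size Ramsey number for paths satisfies r̃(P_k, P_n) ≤ (5/3)·n + 12·k. -/

import Mathlib

namespace OSR

/-- A partial red/blue colouring of the edges of the complete graph on `ℕ`:
`some true` = red, `some false` = blue, `none` = unselected. -/
abbrev Coloring := Sym2 ℕ → Option Bool

/-- The colouring `C` contains a monochromatic path of colour `c` on `k` vertices. -/
def HasPath (C : Coloring) (c : Bool) (k : ℕ) : Prop :=
  ∃ f : Fin k → ℕ, Function.Injective f ∧
    ∀ i j : Fin k, (j : ℕ) = (i : ℕ) + 1 → C s(f i, f j) = some c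

/-- A Builder strategy: given the current position, select an edge. -/
abbrev BuilderStrat := Coloring → Sym2 ℕ

/-- A Painter strategy: given the current position and the selected edge,
choose a colour (`true` = red, `false` = blue). -/
abbrev PainterStrat := Coloring → Sym2 ℕ → Bool

/-- The position after `t` rounds of play, starting from `C0`. -/
def play (C0 : Coloring) (B : BuilderStrat) (P : PainterStrat) : ℕ → Coloring
  | 0 => C0
  | t + 1 =>
    Function.update (play C0 B P t) (B (play C0 B P t))
      (some (P (play C0 B P t) (B (play C0 B P t))))

/-- Builder plays legally: he always selects a previously unselected non-loop edge. -/
def BuilderOK (C0 : Coloring) (B : BuilderStrat) : Prop :=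
  ∀ (P : PainterStrat) (t : ℕ),
    play C0 B P t (B (play C0 B P t)) = none ∧ ¬(B (play C0 B P t)).IsDiag

/-- The empty position: no edge has been coloured. -/
def emptyCol : Coloring := fun _ => none

/-- The online Ramsey game for `(P_k, P_n)` has ended: there is a red path on `k`
vertices or a blue path on `n` vertices. -/
def Ends (k n : ℕ) (C : Coloring) : Prop := HasPath C true k ∨ HasPath C false n

/-- The online size Ramsey number `r̃(P_k, P_n)`: the least `t` such that Builder
has a strategy forcing, against every Painter, a red `P_k` or a blue `P_n`
within at most `t` rounds. -/
noncomputable def onlineRamseyPath (k n : ℕ) : ℕ :=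
  sInf {t : ℕ | ∃ B : BuilderStrat, BuilderOK emptyCol B ∧
    ∀ P : PainterStrat, ∃ s ≤ t, Ends k n (play emptyCol B P s)}

/-- Painter plays legally in the game `RR_H(P_k, ⬝)`: he never colours an edge red
if that would create a red path on `k` vertices. -/
def PainterOK (k : ℕ) (P : PainterStrat) : Prop :=
  ∀ (C : Coloring) (e : Sym2 ℕ),
    ¬HasPath C true k → HasPath (Function.update C e (some true)) true k →
      P C e = false

/-- The colour `c` is an allowed answer of Painter on the edge `e` in position `C`
of the game `RR(P_k, ⬝)`. -/
def Allowed (k : ℕ) (C : Coloring) (e : Sym2 ℕ) (c : Bool) : Prop :=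
  c = true → ¬HasPath C true k → ¬HasPath (Function.update C e (some true)) true k

/-- One round in the variant where Builder may reselect an already coloured edge,
in which case it keeps its colour. -/
def stepR (C : Coloring) (e : Sym2 ℕ) (c : Bool) : Coloring :=
  if C e = none then Function.update C e (some c) else C

/-- The position after `t` rounds, in the variant where a reselected edge keeps
its colour (and the round still counts). -/
def playR (C0 : Coloring) (B : BuilderStrat) (P : PainterStrat) : ℕ → Coloring
  | 0 => C0
  | t + 1 =>
    stepR (playR C0 B P t) (B (playR C0 B P t))
      (P (playR C0 B P t) (B (playR C0 B P t)))

/-- Builder plays legally in the reselection variant: he selects non-loop edges. -/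
def BuilderOKR (C0 : Coloring) (B : BuilderStrat) : Prop :=
  ∀ (P : PainterStrat) (t : ℕ), ¬(B (playR C0 B P t)).IsDiag

/-- Consecutive members of `l` are joined by blue edges. -/
def BlueChain (C : Coloring) (l : List ℕ) : Prop :=
  l.Chain' fun a b => C s(a, b) = some false

/-- Consecutive members of `l` are joined by red edges. -/
def RedChain (C : Coloring) (l : List ℕ) : Prop :=
  l.Chain' fun a b => C s(a, b) = some true

/-- `l` is the vertex sequence of a blue path (on at least one vertex) in `C`. -/
def IsBluePath (C : Coloring) (l : List ℕ) : Prop :=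
  l ≠ [] ∧ l.Nodup ∧ BlueChain C l

/-- `l` is the vertex sequence of a red path (on at least one vertex) in `C`. -/
def IsRedPath (C : Coloring) (l : List ℕ) : Prop :=
  l ≠ [] ∧ l.Nodup ∧ RedChain C l

/-- `x` is an end of the path with vertex sequence `l`. -/
def IsEnd (x : ℕ) (l : List ℕ) : Prop :=
  l.head? = some x ∨ l.getLast? = some x

/-- `e` joins two consecutive vertices of `l`, i.e. `e` is an edge of the path `l`. -/
def IsPathEdge (l : List ℕ) (e : Sym2 ℕ) : Prop :=
  ∃ (i : ℕ) (h : i + 1 < l.length),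
    e = s(l.get ⟨i, Nat.lt_of_succ_lt h⟩, l.get ⟨i + 1, h⟩)

/-- The paths of the family `G` are pairwise vertex-disjoint. -/
def DisjFam {s : ℕ} (G : Fin s → List ℕ) : Prop :=
  ∀ i j, i ≠ j → ∀ x, x ∈ G i → x ∉ G j

/-- `C` contains `T` pairwise vertex-disjoint blue paths of length 2
(i.e. on 3 vertices each). -/
def HasDisjointBluePaths3 (C : Coloring) (T : ℕ) : Prop :=
  ∃ G : Fin T → List ℕ,
    (∀ i, (G i).length = 3 ∧ IsBluePath C (G i)) ∧ DisjFam G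

/-- `(G, u)` witnesses that `C` contains an essential `(s,d,m)`-graph:
`G` lists the `s` pairwise disjoint nonempty essential blue paths,
`u` lists the vertices of the essential red path, `u i` being an end of `G i`,
and the blue paths have `m` vertices in total. -/
def IsEssWitness (C : Coloring) (s d m : ℕ)
    (G : Fin s → List ℕ) (u : Fin d → ℕ) : Prop :=
  (∀ i, IsBluePath C (G i)) ∧ DisjFam G ∧
  Function.Injective u ∧
  (∀ i j : Fin d, (j : ℕ) = (i : ℕ) + 1 → C s(u i, u j) = some true) ∧
  (∀ (i : Fin d) (h : (i : ℕ) < s), IsEnd (u i) (G ⟨i, h⟩)) ∧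
  (∑ i, (G i).length) = m

/-- `C` contains an essential `(s,d,m)`-graph. -/
def IsEssGraph (C : Coloring) (s d m : ℕ) : Prop :=
  d ≤ s ∧ ∃ (G : Fin s → List ℕ) (u : Fin d → ℕ), IsEssWitness C s d m G u

/-- `C` contains an `(s,d,m)`-fence: a red picket `R` on `d` vertices whose last
vertex is the first vertex of the blue picket `G 0`, further pairwise disjoint
nonempty blue pickets `G 1, …`, the blue pickets having `m` vertices in total. -/
def IsFence (C : Coloring) (s d m : ℕ) : Prop :=
  ∃ (hs : 0 < s) (R : List ℕ) (G : Fin s → List ℕ),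
    R.length = d ∧ IsRedPath C R ∧
    (∀ i, IsBluePath C (G i)) ∧ DisjFam G ∧
    R.getLast? = (G ⟨0, hs⟩).head? ∧
    (∀ x ∈ R.dropLast, ∀ i, x ∉ G i) ∧
    (∑ i, (G i).length) = m

/-- There is a red path of length `len` (i.e. on `len + 1` vertices) with end `x`. -/
def RedTailAt (C : Coloring) (x : ℕ) (len : ℕ) : Prop :=
  ∃ l : List ℕ, l.length = len + 1 ∧ l.head? = some x ∧ IsRedPath C l

/-- `l` is a blue `(1,1)`-path: a blue path such that each of its two ends is an
end of a red path of length 1. -/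
def IsBlue11Path (C : Coloring) (l : List ℕ) : Prop :=
  IsBluePath C l ∧
  (∀ x, l.head? = some x → RedTailAt C x 1) ∧
  (∀ x, l.getLast? = some x → RedTailAt C x 1)

/-- `l = [u_1, …, u_k, u_{k+1}]` is an extended `(2,0)`-path: `k ≥ 2`, the edge
`u_k u_{k+1}` is red and `u_1 … u_k` is a blue `(2,0)`-path with `2`-end `u_k`
(its blue end is `u_1`, its transition vertex `u_k`, its red end `u_{k+1}`). -/
def IsExtPath (C : Coloring) (l : List ℕ) : Prop :=
  3 ≤ l.length ∧ l.Nodup ∧ BlueChain C l.dropLast ∧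
  ∀ a b, l.dropLast.getLast? = some a → l.getLast? = some b →
    C s(a, b) = some true ∧ RedTailAt C a 2

/-- The vertices `x 0, …, x 4` form a limb in `C`: blue edges `x0x1`, `x2x3`,
`x1x4` and a red edge `x1x2` (paper notation: blue `x1x2, x3x4, x2x5`, red `x2x3`). -/
def IsLimb (C : Coloring) (x : Fin 5 → ℕ) : Prop :=
  Function.Injective x ∧
  C s(x 0, x 1) = some false ∧ C s(x 2, x 3) = some false ∧
  C s(x 1, x 4) = some false ∧ C s(x 1, x 2) = some true

/-- The four edges of the limb on `x 0, …, x 4`. -/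
def limbEdgeSet (x : Fin 5 → ℕ) : Set (Sym2 ℕ) :=
  {s(x 0, x 1), s(x 2, x 3), s(x 1, x 4), s(x 1, x 2)}

/-- The limb on `x 0, …, x 4` is a component of `C`: every edge of `C` meeting
a limb vertex is an edge of the limb. -/
def LimbComponent (C : Coloring) (x : Fin 5 → ℕ) : Prop :=
  ∀ e, C e ≠ none → (∃ v ∈ e, v ∈ Set.range x) → e ∈ limbEdgeSet x

/-- The red edges of `C` with at least one end in `S`. -/
def RedAt (C : Coloring) (S : Set ℕ) : Set (Sym2 ℕ) :=
  {e | C e = some true ∧ ∃ v ∈ e, v ∈ S}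

/-- The blue edges of `C` with at least one end in `S`. -/
def BlueAt (C : Coloring) (S : Set ℕ) : Set (Sym2 ℕ) :=
  {e | C e = some false ∧ ∃ v ∈ e, v ∈ S}

def redEdges (C : Coloring) : Set (Sym2 ℕ) := {e | C e = some true}

def blueEdges (C : Coloring) : Set (Sym2 ℕ) := {e | C e = some false}

def allEdges (C : Coloring) : Set (Sym2 ℕ) := {e | C e ≠ none}

/-- The vertices of the coloured graph `C` (ends of coloured edges). -/
def supp (C : Coloring) : Set ℕ := {v | ∃ e, C e ≠ none ∧ v ∈ e}

/-- `a` and `b` are adjacent in `C`. -/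
def Adj (C : Coloring) (a b : ℕ) : Prop := a ≠ b ∧ C s(a, b) ≠ none

/-- `G_0 ∪ Red_H(G_0)` is a component of the coloured graph: every blue edge
meeting the blue path `l` is an edge of `l`, and the other end `y` of any red
edge leaving `l` meets only red edges coming back to `l`. -/
def G0Component (C : Coloring) (l : List ℕ) : Prop :=
  (∀ e, C e = some false → (∃ v ∈ e, v ∈ l) → IsPathEdge l e) ∧
  (∀ x ∈ l, ∀ y : ℕ, C s(x, y) = some true → y ∉ l →
    ∀ e, C e ≠ none → y ∈ e → C e = some true ∧ ∃ v ∈ e, v ∈ l)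

/-- The underlying list of an optional path (`∅` has no vertices). -/
def listOf (o : Option (List ℕ)) : List ℕ := o.getD []

/-- The vertex set of an optional limb. -/
def limbVertsOf : Option (Fin 5 → ℕ) → Set ℕ
  | none => ∅
  | some x => Set.range x

/-- The data of the four (possibly empty) essential subgraphs `(G_0, G_1, G_2, L)`
of a good graph: `G0` is a blue path, `G1` a blue `(1,1)`-path, `G2` an extended
`(2,0)`-path (each given by its vertex sequence), and `L` a limb. -/
structure GoodData where
  G0 : Option (List ℕ)
  G1 : Option (List ℕ)
  G2 : Option (List ℕ)
  L : Option (Fin 5 → ℕ)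

def GoodData.vG0 (D : GoodData) : ℕ := (listOf D.G0).length
def GoodData.vG1 (D : GoodData) : ℕ := (listOf D.G1).length
def GoodData.vG2 (D : GoodData) : ℕ := (listOf D.G2).length
def GoodData.vL (D : GoodData) : ℕ := match D.L with | none => 0 | some _ => 5

/-- The number of essential vertices. -/
def GoodData.ess (D : GoodData) : ℕ := D.vG0 + D.vG1 + D.vG2 + D.vL

/-- The set of essential vertices. -/
def GoodData.verts (D : GoodData) : Set ℕ :=
  {v | v ∈ listOf D.G0} ∪ {v | v ∈ listOf D.G1} ∪ {v | v ∈ listOf D.G2} ∪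
    limbVertsOf D.L

/-- The essential subgraphs are pairwise vertex-disjoint. -/
def GoodData.PartsDisjoint (D : GoodData) : Prop :=
  (∀ x ∈ listOf D.G0, x ∉ listOf D.G1) ∧
  (∀ x ∈ listOf D.G0, x ∉ listOf D.G2) ∧
  (∀ x ∈ listOf D.G0, x ∉ limbVertsOf D.L) ∧
  (∀ x ∈ listOf D.G1, x ∉ listOf D.G2) ∧
  (∀ x ∈ listOf D.G1, x ∉ limbVertsOf D.L) ∧
  (∀ x ∈ listOf D.G2, x ∉ limbVertsOf D.L)

/-- At least three of the four essential subgraphs are empty. -/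
def GoodData.Simple (D : GoodData) : Prop :=
  (D.G0 = none ∧ D.G1 = none ∧ D.G2 = none) ∨
  (D.G0 = none ∧ D.G1 = none ∧ D.L = none) ∨
  (D.G0 = none ∧ D.G2 = none ∧ D.L = none) ∨
  (D.G1 = none ∧ D.G2 = none ∧ D.L = none)

/-- `C` is a good graph with essential subgraphs `D = (G_0, G_1, G_2, L)`:
conditions (A)–(F) of the paper, where `⌈2x/5⌉ = (2x+4)/5` in `ℕ`. -/
def IsGood (C : Coloring) (D : GoodData) : Prop :=
  -- `C` is a (finite) coloured graph
  (allEdges C).Finite ∧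
  (∀ e, C e ≠ none → ¬e.IsDiag) ∧
  -- the essential subgraphs are pairwise vertex-disjoint
  D.PartsDisjoint ∧
  -- (A): `L = ∅` or `L` is a limb and a component of `C`
  (∀ x, D.L = some x → IsLimb C x ∧ LimbComponent C x) ∧
  -- (B): `G0 = ∅` or `G0` is a blue path, `G0 ∪ Red_H(G0)` is a component,
  -- and `|Red_H(G0)| ≤ ⌈2 v(G0)/5⌉ - 1`
  (∀ l, D.G0 = some l → IsBluePath C l ∧ G0Component C l ∧
    (RedAt C {v | v ∈ l}).ncard + 1 ≤ (2 * l.length + 4) / 5) ∧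
  -- (C): `G2 = ∅` or `G2` is an extended (2,0)-path on ≥ 3 vertices
  (∀ l, D.G2 = some l → IsExtPath C l) ∧
  -- (C): `G1 = ∅` or `G1` is a blue (1,1)-path whose 1-ends are not adjacent
  -- to the blue end, the red end or the transition vertex of `G2`
  (∀ l, D.G1 = some l → IsBlue11Path C l ∧
    ∀ l2, D.G2 = some l2 → ∀ a, IsEnd a l → ∀ b : ℕ,
      (l2.head? = some b ∨ l2.getLast? = some b ∨ l2.dropLast.getLast? = some b) →
      ¬Adj C a b) ∧
  -- (C): `Blue_H(G1 ∪ G2) \ E(G1 ∪ G2) = ∅`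
  (∀ e, C e = some false → (∃ v ∈ e, v ∈ listOf D.G1 ∨ v ∈ listOf D.G2) →
    IsPathEdge (listOf D.G1) e ∨ IsPathEdge (listOf D.G2) e) ∧
  -- (C): `|Red_H(G1 ∪ G2)| ≤ ⌈2 v(G1 ∪ G2)/5⌉`
  (RedAt C {v | v ∈ listOf D.G1 ∨ v ∈ listOf D.G2}).ncard ≤
    (2 * (D.vG1 + D.vG2) + 4) / 5 ∧
  -- (D), (E): every edge of `C` has an end among the essential vertices
  (∀ e, C e ≠ none → ∃ v ∈ e, v ∈ D.verts) ∧
  -- (F)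
  (5 ∣ D.vG0 ∨ 5 ∣ D.vG1 + D.vG2)

/-- `C` is a very good graph with essential subgraphs `D`: condition (G). -/
def IsVeryGood (C : Coloring) (D : GoodData) : Prop :=
  IsGood C D ∧ 5 ∣ D.vG0 ∧ 5 ∣ D.vG1 + D.vG2

open Classical in
/-- Delete from `C` the vertices of `S` together with all incident edges. -/
noncomputable def deleteVerts (C : Coloring) (S : Set ℕ) : Coloring :=
  fun e => if ∃ v ∈ e, v ∈ S then none else C e

/-- The union of two (edge-disjoint) coloured graphs. -/
def unionCol (C C' : Coloring) : Coloring :=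
  fun e => match C e with
    | some c => some c
    | none => C' e

end OSR

namespace OSR

/-! ### Forcing and Builder's strategy -/

/-- Builder can force a red `P_k` or a blue `P_n` within `t` further rounds. -/
def Force (k n : ℕ) : ℕ → Coloring → Prop
  | 0, C => Ends k n C
  | t + 1, C => Ends k n C ∨ ∃ e, C e = none ∧ ¬e.IsDiag ∧
      ∀ c, Force k n t (Function.update C e (some c))

theorem Force.of_ends {k n t : ℕ} {C : Coloring} (h : Ends k n C) : Force k n t C := by
  cases t with
  | zero => exact h
  | succ t => exact Or.inl h

theorem Force.succ {k n t : ℕ} {C : Coloring} (h : Force k n t C) : Force k n (t + 1) C := by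
  induction t generalizing C with
  | zero => exact Or.inl h
  | succ t ih =>
    rcases h with h | ⟨e, he, hd, h⟩
    · exact Or.inl h
    · exact Or.inr ⟨e, he, hd, fun c => ih (h c)⟩

theorem Force.mono {k n t t' : ℕ} {C : Coloring} (h : Force k n t C) (ht : t ≤ t') :
    Force k n t' C := by
  induction ht with
  | refl => exact h
  | step _ ih => exact ih.succ

/-- `C'` extends the coloured graph `C`. -/
def Extends (C C' : Coloring) : Prop := ∀ e c, C e = some c → C' e = some c

/-- Builder may ask for an edge `xy` regardless of whether it is already coloured. -/
theorem Force.step {k n t : ℕ} {C : Coloring} {x y : ℕ} (hxy : x ≠ y)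
    (h : ∀ C', Extends C C' → ∀ c, C' s(x, y) = some c → Force k n t C') :
    Force k n (t + 1) C := by
  cases he : C s(x, y) with
  | none =>
    refine Or.inr ⟨s(x, y), he, by simpa using hxy, fun c => h _ ?_ c (by simp)⟩
    intro e c' hc
    have : e ≠ s(x, y) := by rintro rfl; simp [he] at hc
    simpa [Function.update_of_ne this] using hc
  | some c => exact (h C (fun _ _ h => h) c he).succ

/-- `e` is a legal move that is optimal in the forcing game at `C`. -/
def GoodMove (k n : ℕ) (C : Coloring) (e : Sym2 ℕ) : Prop :=
  C e = none ∧ ¬e.IsDiag ∧ ∀ t, Force k n (t + 1) C → Ends k n C ∨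
    ∀ c, Force k n t (Function.update C e (some c))

theorem exists_goodMove (k n : ℕ) {C : Coloring} (hC : (allEdges C).Finite) :
    ∃ e, GoodMove k n C e := by
  classical
  obtain ⟨e₀, he₀, hd₀⟩ : ∃ e, C e = none ∧ ¬e.IsDiag := by
    have hinj : Function.Injective fun i : ℕ => s(0, i + 1) := by
      intro i j hij
      simpa using hij
    obtain ⟨_, ⟨i, rfl⟩, hi⟩ := (Set.infinite_range_of_injective hinj).exists_notMem_finite hC
    exact ⟨_, by simpa [allEdges] using hi, by simp⟩
  by_cases hF : ∃ t, Force k n t C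
  · by_cases hE : Ends k n C
    · exact ⟨e₀, he₀, hd₀, fun t _ => Or.inl hE⟩
    obtain ⟨t, ht, hmin⟩ : ∃ t, Force k n t C ∧ ∀ t', Force k n t' C → t ≤ t' :=
      ⟨Nat.find hF, Nat.find_spec hF, fun t' => Nat.find_min' hF⟩
    cases t with
    | zero => exact absurd ht hE
    | succ t =>
      rcases ht with ht | ⟨e, he, hd, h⟩
      · exact absurd ht hE
      · exact ⟨e, he, hd, fun t' ht' => Or.inr fun c =>
          (h c).mono (Nat.le_of_succ_le_succ (hmin _ ht'))⟩
  · exact ⟨e₀, he₀, hd₀, fun t ht => absurd ⟨_, ht⟩ hF⟩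

open Classical in
/-- Builder's strategy that always selects an optimal legal move. -/
noncomputable def optimalStrat (k n : ℕ) : BuilderStrat := fun C =>
  if h : ∃ e, GoodMove k n C e then h.choose else s(0, 1)

theorem goodMove_optimalStrat (k n : ℕ) {C : Coloring} (hC : (allEdges C).Finite) :
    GoodMove k n C (optimalStrat k n C) := by
  have h := exists_goodMove k n hC
  rw [optimalStrat, dif_pos h]
  exact h.choose_spec

theorem allEdges_update_finite {C : Coloring} (hC : (allEdges C).Finite) (e : Sym2 ℕ) (c : Bool) :
    (allEdges (Function.update C e (some c))).Finite := by
  refine (hC.insert e).subset fun e' he' => ?_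
  by_cases h : e' = e
  · exact Or.inl h
  · right
    simpa [allEdges, Function.update_of_ne h] using he'

theorem allEdges_play_finite {C : Coloring} (hC : (allEdges C).Finite) (B : BuilderStrat)
    (P : PainterStrat) (t : ℕ) : (allEdges (play C B P t)).Finite := by
  induction t with
  | zero => exact hC
  | succ t ih => exact allEdges_update_finite ih _ _

theorem play_succ' (C : Coloring) (B : BuilderStrat) (P : PainterStrat) (t : ℕ) :
    play C B P (t + 1) = play (Function.update C (B C) (some (P C (B C)))) B P t := by
  induction t with
  | zero => rfl
  | succ t ih => rw [play, ih]; rfl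

theorem Force.exists_ends_play {k n t : ℕ} {C : Coloring} (h : Force k n t C)
    (hC : (allEdges C).Finite) (P : PainterStrat) :
    ∃ s ≤ t, Ends k n (play C (optimalStrat k n) P s) := by
  induction t generalizing C with
  | zero => exact ⟨0, le_rfl, h⟩
  | succ t ih =>
    rcases (goodMove_optimalStrat k n hC).2.2 t h with h' | h'
    · exact ⟨0, Nat.zero_le _, h'⟩
    · obtain ⟨s, hs, hE⟩ := ih (h' (P C (optimalStrat k n C))) (allEdges_update_finite hC _ _)
      exact ⟨s + 1, Nat.succ_le_succ hs, by rwa [play_succ']⟩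

theorem Force.onlineRamseyPath_le {k n t : ℕ} (h : Force k n t emptyCol) :
    onlineRamseyPath k n ≤ t := by
  have hfin : (allEdges emptyCol).Finite := by simp [allEdges, emptyCol]
  refine Nat.sInf_le ⟨optimalStrat k n, fun P t => ?_, fun P => h.exists_ends_play hfin P⟩
  have := goodMove_optimalStrat k n (allEdges_play_finite hfin (optimalStrat k n) P t)
  exact ⟨this.1, this.2.1⟩

/-! ### Monochromatic chains -/

/-- Consecutive members of `l` are joined by edges of colour `c`. -/
abbrev MonoChain (C : Coloring) (c : Bool) (l : List ℕ) : Prop :=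
  l.IsChain fun a b => C s(a, b) = some c

theorem MonoChain.extends {C C' : Coloring} {c : Bool} {l : List ℕ} (h : MonoChain C c l)
    (hC : Extends C C') : MonoChain C' c l :=
  List.IsChain.imp (fun _ _ => hC _ _) h

theorem MonoChain.hasPath {C : Coloring} {c : Bool} {l : List ℕ} {k : ℕ} (h : MonoChain C c l)
    (hl : l.Nodup) (hk : k ≤ l.length) : HasPath C c k := by
  refine ⟨fun i => l[(i : ℕ)], fun i j hij => ?_, fun i j hij => ?_⟩
  · exact Fin.ext ((List.Nodup.getElem_inj_iff hl).1 hij)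
  · have := List.isChain_iff_getElem.1 h i (by have := j.2; omega)
    simpa only [hij] using this

theorem MonoChain.join {C : Coloring} {c : Bool} {x y : ℕ} {l m : List ℕ}
    (hl : MonoChain C c (x :: l)) (hm : MonoChain C c (y :: m)) (h : C s(x, y) = some c) :
    MonoChain C c ((x :: l).reverse ++ y :: m) := by
  refine List.isChain_append.2 ⟨List.isChain_reverse.2 ?_, hm, ?_⟩
  · exact List.IsChain.imp (fun a b hab => by rwa [Sym2.eq_swap]) hl
  · simpa using h

/-! ### Combs: a red path on ends of some of a family of disjoint blue paths -/

/-- The vertices of the blue paths of a comb. -/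
def combVerts (S : List (ℕ × List ℕ)) (D : List (List ℕ)) : List ℕ :=
  S.flatMap (fun p => p.1 :: p.2) ++ D.flatten

/-- The lists `x :: l` for `(x, l) ∈ S` together with the members of `D` are pairwise disjoint
blue paths, and the vertices `x` form a red path. -/
structure IsComb (C : Coloring) (S : List (ℕ × List ℕ)) (D : List (List ℕ)) : Prop where
  red : MonoChain C true (S.map Prod.fst)
  blueS : ∀ p ∈ S, MonoChain C false (p.1 :: p.2)
  blueD : ∀ l ∈ D, MonoChain C false l
  nodup : (combVerts S D).Nodup

section Comb

variable {C C' : Coloring} {S : List (ℕ × List ℕ)} {D : List (List ℕ)} {k n x y : ℕ}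
  {l m : List ℕ}

theorem IsComb.extends (h : IsComb C S D) (hC : Extends C C') : IsComb C' S D :=
  ⟨h.red.extends hC, fun p hp => (h.blueS p hp).extends hC,
    fun l hl => (h.blueD l hl).extends hC, h.nodup⟩

theorem map_fst_sublist_flatMap (S : List (ℕ × List ℕ)) :
    (S.map Prod.fst).Sublist (S.flatMap fun p => p.1 :: p.2) := by
  induction S with
  | nil => simp
  | cons p S ih =>
    simp only [List.map_cons, List.flatMap_cons, List.cons_append]
    exact (ih.trans (List.sublist_append_right _ _)).cons_cons _

theorem IsComb.ends_of_le (h : IsComb C S D) (hk : k ≤ S.length) : Ends k n C :=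
  Or.inl <| h.red.hasPath (k := k)
    (h.nodup.sublist ((map_fst_sublist_flatMap S).trans (List.sublist_append_left _ _)))
    (by simpa using hk)

theorem IsComb.ne (h : IsComb C ((x, l) :: S) ((y :: m) :: D)) : x ≠ y := by
  rintro rfl
  have := h.nodup
  simp [combVerts] at this

theorem IsComb.push (h : IsComb C ((x, l) :: S) ((y :: m) :: D)) (hxy : C s(x, y) = some true) :
    IsComb C ((y, m) :: (x, l) :: S) D where
  red := List.IsChain.cons_cons (by rwa [Sym2.eq_swap]) h.red
  blueS := by
    have h1 := h.blueS
    have h2 := h.blueD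
    simp only [List.forall_mem_cons] at h1 h2 ⊢
    exact ⟨h2.1, h1⟩
  blueD := fun l hl => h.blueD l (List.mem_cons_of_mem _ hl)
  nodup := by
    refine (List.Perm.nodup_iff ?_).1 h.nodup
    rw [List.perm_iff_count]
    intro a
    simp only [combVerts, List.flatMap_cons, List.flatten_cons, List.count_append, List.count_cons]
    omega

theorem IsComb.join (h : IsComb C ((x, l) :: S) ((y :: m) :: D)) (hxy : C s(x, y) = some false) :
    IsComb C S (((x :: l).reverse ++ y :: m) :: D) where
  red := List.IsChain.tail h.red
  blueS := fun p hp => h.blueS p (List.mem_cons_of_mem _ hp)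
  blueD := by
    have h1 := h.blueS
    have h2 := h.blueD
    simp only [List.forall_mem_cons] at h1 h2 ⊢
    exact ⟨MonoChain.join h1.1 h2.1 hxy, h2.2⟩
  nodup := by
    refine (List.Perm.nodup_iff ?_).1 h.nodup
    rw [List.perm_iff_count]
    intro a
    simp only [combVerts, List.flatMap_cons, List.flatten_cons, List.count_append, List.count_cons,
      List.count_reverse]
    omega

theorem IsComb.absorb (h : IsComb C ((x, []) :: S) ((y :: m) :: D))
    (hxy : C s(x, y) = some false) : IsComb C ((x, y :: m) :: S) D where
  red := h.red
  blueS := by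
    have h1 := h.blueS
    have h2 := h.blueD
    simp only [List.forall_mem_cons] at h1 h2 ⊢
    exact ⟨List.IsChain.cons_cons hxy h2.1, h1.2⟩
  blueD := fun l hl => h.blueD l (List.mem_cons_of_mem _ hl)
  nodup := by
    refine (List.Perm.nodup_iff ?_).1 h.nodup
    rw [List.perm_iff_count]
    intro a
    simp only [combVerts, List.flatMap_cons, List.flatten_cons, List.count_append, List.count_cons,
      List.count_nil]
    omega

theorem IsComb.start (h : IsComb C [] ((y :: m) :: D)) : IsComb C [(y, m)] D where
  red := List.IsChain.singleton _
  blueS := by simpa using h.blueD _ List.mem_cons_self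
  blueD := fun l hl => h.blueD l (List.mem_cons_of_mem _ hl)
  nodup := by simpa [combVerts] using h.nodup

theorem IsComb.drop_nil (h : IsComb C S ([] :: D)) : IsComb C S D where
  red := h.red
  blueS := h.blueS
  blueD := fun l hl => h.blueD l (List.mem_cons_of_mem _ hl)
  nodup := by simpa [combVerts] using h.nodup

theorem IsComb.exists_fresh (h : IsComb C S D) : ∃ x, IsComb C S ([x] :: D) := by
  obtain ⟨x, hx⟩ := Infinite.exists_notMem_finset (combVerts S D).toFinset
  rw [List.mem_toFinset] at hx
  refine ⟨x, h.red, h.blueS, ?_, ?_⟩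
  · simpa using h.blueD
  · refine (List.Perm.nodup_iff ?_).1 (List.nodup_cons.2 ⟨hx, h.nodup⟩)
    rw [List.perm_iff_count]
    intro a
    simp only [combVerts, List.flatten_cons, List.count_append, List.count_cons, List.count_nil]
    omega

theorem IsComb.trim (h : IsComb C ((y, m) :: (x, l) :: S) D) :
    IsComb C ((y, m) :: (x, []) :: S) (l :: D) where
  red := h.red
  blueS := by
    have h1 := h.blueS
    simp only [List.forall_mem_cons] at h1 ⊢
    exact ⟨h1.1, List.IsChain.singleton _, h1.2.2⟩
  blueD := by
    have h1 := h.blueS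
    simp only [List.forall_mem_cons] at h1 ⊢
    exact ⟨List.IsChain.tail h1.2.1, h.blueD⟩
  nodup := by
    refine (List.Perm.nodup_iff ?_).1 h.nodup
    rw [List.perm_iff_count]
    intro a
    simp only [combVerts, List.flatMap_cons, List.flatten_cons, List.count_append, List.count_cons,
      List.count_nil]
    omega

theorem IsComb.release (h : IsComb C S D) :
    IsComb C [] (S.map (fun p => p.1 :: p.2) ++ D) where
  red := List.IsChain.nil
  blueS := by simp
  blueD := by
    intro l hl
    rcases List.mem_append.1 hl with hl | hl
    · obtain ⟨p, hp, rfl⟩ := List.mem_map.1 hl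
      exact h.blueS p hp
    · exact h.blueD l hl
  nodup := by simpa [combVerts, List.flatMap_def] using h.nodup

theorem IsComb.forget (h : IsComb C S D) : IsComb C [] D where
  red := List.IsChain.nil
  blueS := by simp
  blueD := h.blueD
  nodup := by
    simpa [combVerts] using h.nodup.sublist (List.sublist_append_right _ _)

/-! ### Builder's strategy -/

/-- Few blue paths are merged into one, losing less than `k` vertices. -/
theorem IsComb.force_of_singletons {N : ℕ} {R : List ℕ}
    (h : IsComb C ((x, l) :: R.map fun r => (r, [])) D)
    (hn : n + k ≤ (combVerts ((x, l) :: R.map fun r => (r, [])) D).length)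
    (hN : 3 * D.length + k ≤ N + R.length) : Force k n N C := by
  induction N using Nat.strong_induction_on generalizing C x l R D with
  | _ N ih =>
  induction D with
  | nil =>
    by_cases hk : k ≤ R.length + 1
    · exact Force.of_ends (h.ends_of_le (by simpa using hk))
    refine Force.of_ends (Or.inr (MonoChain.hasPath (h.blueS _ List.mem_cons_self) ?_ ?_))
    · exact h.nodup.sublist (by simp [combVerts])
    · simp [combVerts, List.flatMap_map] at hn ⊢
      omega
  | cons p D ihD =>
  cases p with
  | nil => exact ihD h.drop_nil (by simpa [combVerts] using hn) (by simp at hN; omega)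
  | cons y m =>
  by_cases hk : k ≤ R.length + 1
  · exact Force.of_ends (h.ends_of_le (by simpa using hk))
  simp only [List.length_cons] at hN
  obtain ⟨N, rfl⟩ : ∃ N', N = N' + 2 := ⟨N - 2, by omega⟩
  refine Force.step h.ne fun C' hC c hc => ?_
  have h' := h.extends hC
  cases c with
  | true =>
    refine ih (N + 1) (by omega) (R := x :: R) (h'.push hc).trim ?_ ?_
    · simp [combVerts, List.flatMap_map] at hn ⊢
      omega
    · simp
      omega
  | false =>
    have hj := h'.join hc
    obtain ⟨g, q, hg⟩ : ∃ g q, (x :: l).reverse ++ y :: m = g :: q :=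
      List.exists_cons_of_ne_nil (by simp)
    have hlen := congrArg List.length hg
    simp at hlen
    rw [hg] at hj
    cases R with
    | nil =>
      refine ih (N + 1) (by omega) (R := []) hj.start ?_ ?_
      · simp [combVerts] at hn ⊢
        omega
      · simp at hN ⊢
        omega
    | cons r R =>
    refine Force.step (IsComb.ne hj) fun C'' hC' c hc' => ?_
    have hj' := hj.extends hC'
    simp only [List.length_cons] at hN
    cases c with
    | true =>
      refine ih N (by omega) (R := r :: R) (hj'.push hc') ?_ ?_
      · simp [combVerts, List.flatMap_map] at hn ⊢
        omega
      · simp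
        omega
    | false =>
      refine ih N (by omega) (hj'.absorb hc') ?_ ?_
      · simp [combVerts, List.flatMap_map] at hn ⊢
        omega
      · omega

theorem IsComb.force_of_few {N : ℕ} (h : IsComb C [] D) (hn : n + k ≤ D.flatten.length)
    (hN : 3 * D.length + k ≤ N) : Force k n N C := by
  induction D with
  | nil =>
    obtain rfl : n = 0 := by simp at hn; omega
    exact Force.of_ends (Or.inr ⟨Fin.elim0, fun i => i.elim0, fun i => i.elim0⟩)
  | cons p D ih =>
  cases p with
  | nil => exact ih h.drop_nil (by simpa using hn) (by simp at hN; omega)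
  | cons y m =>
    refine IsComb.force_of_singletons (R := []) h.start ?_ ?_
    · simpa [combVerts] using hn
    · simp at hN ⊢
      omega

/-- Many blue paths are merged, at a cost of two rounds each, until less than `k` remain. -/
theorem IsComb.force_of_many {N : ℕ} (h : IsComb C S D) (hn : n + k ≤ (combVerts S D).length)
    (hN : 2 * D.length + S.length + 4 * k ≤ N) : Force k n N C := by
  induction N using Nat.strong_induction_on generalizing C S D with
  | _ N ih =>
  by_cases hk : k ≤ S.length
  · exact Force.of_ends (h.ends_of_le hk)
  cases D with
  | nil =>
    refine h.release.force_of_few ?_ ?_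
    · simpa [combVerts, List.flatMap_def] using hn
    · simp
      omega
  | cons p D =>
  simp only [List.length_cons] at hN
  obtain ⟨N, rfl⟩ : ∃ N', N = N' + 1 := ⟨N - 1, by omega⟩
  cases p with
  | nil => exact (ih N (by omega) h.drop_nil (by simpa [combVerts] using hn) (by omega)).succ
  | cons y m =>
  cases S with
  | nil =>
    refine (ih N (by omega) h.start (by simpa [combVerts] using hn) ?_).succ
    simp at hN ⊢
    omega
  | cons p S =>
  obtain ⟨x, l⟩ := p
  simp only [List.length_cons] at hN
  refine Force.step h.ne fun C' hC c hc => ?_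
  have h' := h.extends hC
  cases c with
  | true =>
    refine ih N (by omega) (h'.push hc) ?_ ?_
    · simp [combVerts] at hn ⊢
      omega
    · simp
      omega
  | false =>
    refine ih N (by omega) (h'.join hc) ?_ ?_
    · simp [combVerts] at hn ⊢
      omega
    · simp
      omega

theorem length_flatMap_le (hS : ∀ p ∈ S, p.2.length ≤ 1) :
    (S.flatMap fun p => p.1 :: p.2).length ≤ 2 * S.length := by
  induction S with
  | nil => simp
  | cons p S ih =>
    simp only [List.forall_mem_cons] at hS
    have := ih hS.2
    simp only [List.flatMap_cons, List.length_append, List.length_cons]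
    omega

/-- Builder collects blue paths on three vertices at a cost of three rounds each. -/
theorem IsComb.force_of_short {N T M : ℕ} (h : IsComb C S D) (hS : ∀ p ∈ S, p.2.length ≤ 1)
    (hD : ∀ l ∈ D, l.length = 3) (hT : D.length ≤ T)
    (hM : ∀ C D, IsComb C [] D → (∀ l ∈ D, l.length = 3) → D.length = T → Force k n M C)
    (hN : 3 * (T - D.length) + 2 * k + M ≤ N + (S.flatMap fun p => p.1 :: p.2).length) :
    Force k n N C := by
  induction N generalizing C S D with
  | zero =>
    by_cases hk : k ≤ S.length
    · exact Force.of_ends (h.ends_of_le hk)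
    · have := length_flatMap_le hS
      omega
  | succ N ih =>
  by_cases hk : k ≤ S.length
  · exact Force.of_ends (h.ends_of_le hk)
  have hlen := length_flatMap_le hS
  by_cases hDT : D.length = T
  · exact (hM C D h.forget hD hDT).mono (by omega)
  obtain ⟨x, l, S', h, hS, hN⟩ : ∃ x l S', IsComb C ((x, l) :: S') D ∧
      (∀ p ∈ (x, l) :: S', p.2.length ≤ 1) ∧ 3 * (T - D.length) + 2 * k + M ≤
        N + 1 + (((x, l) :: S').flatMap fun p => p.1 :: p.2).length := by
    cases S with
    | nil =>
      obtain ⟨x, hx⟩ := h.exists_fresh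
      exact ⟨x, [], [], hx.start, by simp, by simp at hN ⊢; omega⟩
    | cons p S => exact ⟨p.1, p.2, S, h, hS, hN⟩
  obtain ⟨y, h⟩ := h.exists_fresh
  simp only [List.forall_mem_cons] at hS
  refine Force.step h.ne fun C' hC c hc => ?_
  have h' := h.extends hC
  cases c with
  | true =>
    refine ih (h'.push hc) (by simpa using hS) hD hT ?_
    simp at hN ⊢
    omega
  | false =>
    cases l with
    | nil =>
      refine ih (h'.absorb hc) (by simpa using hS.2) hD hT ?_
      simp at hN ⊢
      omega
    | cons z l =>
      obtain rfl : l = [] := by simpa using hS.1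
      refine ih (h'.join hc) hS.2 (by simpa using hD) (by simp; omega) ?_
      simp at hN ⊢
      omega

end Comb

theorem isComb_nil (C : Coloring) : IsComb C [] [] :=
  ⟨List.IsChain.nil, by simp, by simp, by simp [combVerts]⟩

theorem force_emptyCol {k n T : ℕ} (hT : n + k ≤ 3 * T) :
    Force k n (5 * T + 6 * k) emptyCol := by
  refine (isComb_nil emptyCol).force_of_short (T := T) (M := 2 * T + 4 * k) (by simp) (by simp)
    (by simp) (fun C D h hD hDT => h.force_of_many ?_ (by simp [hDT])) ?_
  · have : D.flatten.length = 3 * T := by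
      rw [List.length_flatten, List.map_congr_left hD]
      simp [hDT, mul_comm]
    simpa [combVerts, this] using hT
  · simp
    omega

end OSR


/-- **Theorem 1 (off-diagonal online size Ramsey numbers for paths).**
For all `n, k ∈ ℕ` with `k ≥ 5`, `r̃(P_k, P_n) ≤ (5/3)·n + 12·k`. -/
theorem OSR.onlineRamseyPath_le_of_five_le (n k : ℕ) (hk : 5 ≤ k) :
    (OSR.onlineRamseyPath k n : ℝ) ≤ 5 / 3 * n + 12 * k := by
  have hT : n + k ≤ 3 * ((n + k + 2) / 3) := by omega
  have h := (OSR.force_emptyCol hT).onlineRamseyPath_le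
  have h' : 3 * OSR.onlineRamseyPath k n ≤ 5 * n + 36 * k := by omega
  have h'' : (3 * OSR.onlineRamseyPath k n : ℝ) ≤ 5 * n + 36 * k := by exact_mod_cast h'
  linarith
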